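/- If P is an FLC and well-separated pattern on E that is L-sub with predecessor P' and L expansive, then P' is locally isomorphic to P (equivalently, Ω_P = Ω_{P'}). -/

import Mathlib

open Metric Set Filter Topology Pointwise

variable {E : Type*} [NormedAddCommGroup E] [NormedSpace ℝ E] {S : Type*}

/-- Equality of the `U`-patches of the pattern `P` at `x` and of `Q` at `y`:
`P[x,U] = Q[y,U]`. -/
def PatchEq (P Q : E → S) (x y : E) (U : Set E) : Prop :=
  ∀ u ∈ U, P (x + u) = Q (y + u)

/-- The translate `P + z` of a pattern `P`. -/
def transl (z : E) (P : E → S) : E → S := fun x => P (x - z)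

/-- The distortion `L P` of a pattern `P` by a linear automorphism `L`. -/
def distort (L : E ≃ₗ[ℝ] E) (P : E → S) : E → S := fun x => P (L.symm x)

/-- `Q` is locally indistinguishable from `P` (`Q ≼ P`). -/
def LIfrom (Q P : E → S) : Prop :=
  ∀ U : Set E, IsCompact U → ∀ x : E, ∃ y : E, PatchEq Q P x y U

/-- `P` and `Q` are locally isomorphic (`P ≈ Q`). -/
def LocIso (P Q : E → S) : Prop :=
  LIfrom P Q ∧ LIfrom Q P

/-- `Q` is locally derivable from `P` (`P ⊳ Q`). -/
def LD (P Q : E → S) : Prop :=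
  ∃ c : ℝ, 0 ≤ c ∧ ∀ x y : E, PatchEq P P x y (closedBall 0 c) → Q x = Q y

/-- The group of translational periods of a pattern: `{g | P + g = P}`. -/
def periods (P : E → S) : AddSubgroup E where
  carrier := {g : E | ∀ x : E, P (x + g) = P x}
  zero_mem' := by intro x; rw [add_zero]
  add_mem' := by
    intro a b ha hb
    simp only [Set.mem_setOf_eq] at ha hb ⊢
    intro x
    rw [← add_assoc, hb, ha]
  neg_mem' := by
    intro a ha
    simp only [Set.mem_setOf_eq] at ha ⊢
    intro x
    have h := ha (x + -a)
    have h2 : x + -a + a = x := by abel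
    rw [h2] at h
    exact h.symm

/-- Finite local complexity (FLC) for a single pattern. -/
def IsFLC (P : E → S) : Prop :=
  ∀ U : Set E, IsCompact U → ∃ K : Set E, IsCompact K ∧ ∀ x : E, ∃ v ∈ K, PatchEq P P x v U

/-- Repetitivity for a single pattern. -/
def Repetitive (P : E → S) : Prop :=
  ∀ U : Set E, IsCompact U →
    ∃ R : Set E, IsCompact R ∧ ∀ x y : E, ∃ v ∈ R, PatchEq P P x (y + v) U

/-- Well-separation for a single pattern. -/
def WellSeparated (P : E → S) : Prop :=
  ∃ V : Set E, IsCompact V ∧ ∀ x y : E, P x ≠ P y →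
    ∃ B ∈ 𝓝 (0 : E), ∀ b ∈ B, ∀ b' ∈ B, ¬ PatchEq P P (x + b) (y + b') V

/-- Return discreteness for a single pattern. -/
def ReturnDiscrete (P : E → S) : Prop :=
  ∃ B ∈ 𝓝 (0 : E), ∃ V : Set E, IsCompact V ∧
    ∀ x : E, ∀ b ∈ B, PatchEq P P x (x + b) V → b = 0

/-- The translational hull of a pattern: all patterns locally indistinguishable from it. -/
def patternHull (P : E → S) : Set (E → S) := {Q | LIfrom Q P}

/-- A pattern space: a nonempty set of patterns closed under being locally
indistinguishable from the collection. -/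
def IsPatternSpace (Ω : Set (E → S)) : Prop :=
  Ω.Nonempty ∧ ∀ Q : E → S,
    (∀ U : Set E, IsCompact U → ∀ x : E, ∃ R ∈ Ω, ∃ y : E, PatchEq Q R x y U) → Q ∈ Ω

/-- Finite local complexity for a pattern space. -/
def IsFLCSpace (Ω : Set (E → S)) : Prop :=
  ∀ U : Set E, IsCompact U → ∃ (n : ℕ) (Ps : Fin n → E → S) (Ks : Fin n → Set E),
    (∀ i, IsCompact (Ks i)) ∧ ∀ Q ∈ Ω, ∀ x : E, ∃ i, ∃ y ∈ Ks i, PatchEq Q (Ps i) x y U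

/-- Well-separation for a pattern space. -/
def WellSeparatedSpace (Ω : Set (E → S)) : Prop :=
  ∃ V : Set E, IsCompact V ∧ ∀ P ∈ Ω, ∀ Q ∈ Ω, P 0 ≠ Q 0 →
    ∃ B ∈ 𝓝 (0 : E), ∀ b ∈ B, ∀ b' ∈ B, ¬ PatchEq P Q b b' V

/-- Return discreteness for a pattern space. -/
def ReturnDiscreteSpace (Ω : Set (E → S)) : Prop :=
  ∃ B ∈ 𝓝 (0 : E), ∃ V : Set E, IsCompact V ∧
    ∀ P ∈ Ω, ∀ b ∈ B, PatchEq P P 0 b V → b = 0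

/-- Repetitivity for a pattern space. -/
def RepetitiveSpace (Ω : Set (E → S)) : Prop :=
  ∀ U : Set E, IsCompact U → ∃ R : Set E, IsCompact R ∧
    ∀ P ∈ Ω, ∀ Q ∈ Ω, ∃ v ∈ R, PatchEq P Q 0 v U

/-- A local derivation (LD) map between two sets of patterns. -/
def IsLDMapOn (f : (E → S) → (E → S)) (Ω Ω' : Set (E → S)) : Prop :=
  Set.MapsTo f Ω Ω' ∧ ∃ c : ℝ, 0 ≤ c ∧
    ∀ P ∈ Ω, ∀ Q ∈ Ω, ∀ x y : E, PatchEq P Q x y (closedBall 0 c) → f P x = f Q y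

/-- An expansive linear automorphism (all eigenvalues of modulus strictly greater
than `1`; equivalently, iterates expand uniformly at an exponential rate). -/
def IsExpansive (L : E ≃ₗ[ℝ] E) : Prop :=
  ∃ C > (0 : ℝ), ∃ l > (1 : ℝ), ∀ (n : ℕ) (x : E), C * l ^ n * ‖x‖ ≤ ‖(L ^ n : E ≃ₗ[ℝ] E) x‖

/-- `P` is `L`-sub with predecessor `P'`: `P' ≼ P` and `L P' ⊳ P`. -/
def IsLSub (L : E ≃ₗ[ℝ] E) (P P' : E → S) : Prop :=
  LIfrom P' P ∧ LD (distort L P') P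

/-- An `L`-sub pattern space: `Ω` together with a surjective LD (subdivision) map
`S : L Ω → Ω`. -/
def IsLSubSpace (L : E ≃ₗ[ℝ] E) (Ω : Set (E → S)) (Sub : (E → S) → (E → S)) : Prop :=
  IsLDMapOn Sub (distort L '' Ω) Ω ∧ Set.SurjOn Sub (distort L '' Ω) Ω

/-- The substitution map `σ := S ∘ L`. -/
def substMap (L : E ≃ₗ[ℝ] E) (Sub : (E → S) → (E → S)) : (E → S) → (E → S) :=
  fun Q => Sub (distort L Q)


theorem LIfrom.trans {F T : Type*} [NormedAddCommGroup F] {P Q R : F → T} (h : LIfrom P Q) (h' : LIfrom Q R) : LIfrom P R := by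
  intro U hU x
  obtain ⟨y, hy⟩ := h U hU x
  obtain ⟨z, hz⟩ := h' U hU y
  exact ⟨z, fun u hu => (hy u hu).trans (hz u hu)⟩

/-- The set of positions, relative to `L x`, at which an image pattern derived with radius `c`
is determined by the `U`-patch at `x`. -/
def inflate (L : E ≃ₗ[ℝ] E) (c : ℝ) (U : Set E) : Set E :=
  {u | ∀ b ∈ closedBall (0 : E) c, L.symm (u + b) ∈ U}

theorem inflate_mono (L : E ≃ₗ[ℝ] E) (c : ℝ) {U V : Set E} (h : U ⊆ V) :
    inflate L c U ⊆ inflate L c V :=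
  fun _ hu b hb => h (hu b hb)

theorem inflate_subset_image (L : E ≃ₗ[ℝ] E) {c : ℝ} (hc : 0 ≤ c) {U K : Set E} (h : U ⊆ K) :
    inflate L c U ⊆ L '' K := by
  intro u hu
  have h0 := hu 0 (mem_closedBall_self hc)
  rw [add_zero] at h0
  exact ⟨L.symm u, h h0, L.apply_symm_apply u⟩

/-- The points `y` such that the patch `P[y,U]` occurs in `P'` and has a chain of `n` successive
images under the derivation of `P` from `L P'`, all but the last of which occur in `P'`. -/
def chainPoints (L : E ≃ₗ[ℝ] E) (c : ℝ) (P P' : E → S) : ℕ → Set E → Set E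
  | 0, _ => univ
  | n + 1, U => {y | ∃ x, PatchEq P P' y x U ∧ L x ∈ chainPoints L c P P' n (inflate L c U)}

section ChainPoints

variable {L : E ≃ₗ[ℝ] E} {c : ℝ} {P P' : E → S}

theorem chainPoints_add (n : ℕ) {U V : Set E} {u y : E} (hVU : ∀ v ∈ V, u + v ∈ U)
    (hy : y ∈ chainPoints L c P P' n U) : y + u ∈ chainPoints L c P P' n V := by
  induction n generalizing U V u y with
  | zero => trivial
  | succ n ih =>
    obtain ⟨x, hx, hLx⟩ := hy
    refine ⟨x + u, fun v hv => ?_, ?_⟩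
    · simpa only [add_assoc] using hx (u + v) (hVU v hv)
    · rw [map_add]
      refine ih (U := inflate L c U) (fun v (hv : v ∈ inflate L c V) b hb => ?_) hLx
      have h := hVU _ (hv b hb)
      simpa only [map_add, LinearEquiv.symm_apply_apply, add_assoc] using h

theorem chainPoints_congr (n : ℕ) {U : Set E} {y z : E} (h : PatchEq P P z y U)
    (hy : y ∈ chainPoints L c P P' n U) : z ∈ chainPoints L c P P' n U := by
  cases n with
  | zero => trivial
  | succ n =>
    obtain ⟨x, hx, hLx⟩ := hy
    exact ⟨x, fun u hu => (h u hu).trans (hx u hu), hLx⟩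

theorem chainPoints_succ_subset (n : ℕ) (U : Set E) :
    chainPoints L c P P' (n + 1) U ⊆ chainPoints L c P P' n U := by
  induction n generalizing U with
  | zero => exact fun _ _ => trivial
  | succ n ih =>
    rintro y ⟨x, hx, hLx⟩
    exact ⟨x, hx, ih _ hLx⟩

theorem patchEq_inflate
    (hLD : ∀ x y, PatchEq (distort L P') (distort L P') x y (closedBall 0 c) → P x = P y)
    {U : Set E} {x y : E} (h : PatchEq P' P' x y U) :
    PatchEq P P (L x) (L y) (inflate L c U) := by
  intro u hu
  refine hLD _ _ fun b hb => ?_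
  have h' := h _ (hu b hb)
  simpa only [distort, map_add, LinearEquiv.symm_apply_apply, add_assoc] using h'

theorem chainPoints_descend (hLI : LIfrom P' P)
    (hLD : ∀ x y, PatchEq (distort L P') (distort L P') x y (closedBall 0 c) → P x = P y)
    (n : ℕ) {V W K : Set E} (hVW : V ⊆ W) (hK : IsCompact K) (hWK : W ⊆ K)
    (h : chainPoints L c P P' (n + 1) W ⊆ chainPoints L c P P' (n + 2) V) :
    chainPoints L c P P' n (inflate L c W) ⊆ chainPoints L c P P' (n + 1) (inflate L c V) := by
  intro y hy
  obtain ⟨w, hw⟩ := hLI K hK (L.symm y)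
  have hwW : w ∈ chainPoints L c P P' (n + 1) W :=
    ⟨L.symm y, fun u hu => (hw u (hWK hu)).symm, by rwa [L.apply_symm_apply]⟩
  obtain ⟨x, hx, hLx⟩ := h hwW
  have key : PatchEq P' P' (L.symm y) x V :=
    fun u hu => (hw u (hWK (hVW hu))).trans (hx u hu)
  have key' := patchEq_inflate hLD key
  rw [L.apply_symm_apply] at key'
  exact chainPoints_congr _ key' hLx

theorem exists_patchEq_of_chainPoints_subset [FiniteDimensional ℝ E] (hc : 0 ≤ c)
    (hLI : LIfrom P' P)
    (hLD : ∀ x y, PatchEq (distort L P') (distort L P') x y (closedBall 0 c) → P x = P y)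
    (n : ℕ) {V W K : Set E} (hVW : V ⊆ W) (hK : IsCompact K) (hWK : W ⊆ K)
    (hV : V ⊆ inflate L c V)
    (h : chainPoints L c P P' n W ⊆ chainPoints L c P P' (n + 1) V) (y : E) :
    ∃ x, PatchEq P P' y x V := by
  induction n generalizing V W K with
  | zero =>
    obtain ⟨x, hx, -⟩ := h (mem_univ y)
    exact ⟨x, hx⟩
  | succ n ih =>
    have hL : Continuous L := L.toLinearMap.continuous_of_finiteDimensional
    obtain ⟨x, hx⟩ := ih (inflate_mono L c hVW) (hK.image hL) (inflate_subset_image L hc hWK)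
      (inflate_mono L c hV) (chainPoints_descend hLI hLD n hVW hK hWK h)
    exact ⟨x, fun u hu => hx u (hV hu)⟩

theorem exists_chainPoints_subset (hFLC : IsFLC P) {V W M : Set E} (hW : IsCompact W)
    (hVM : ∀ v ∈ V, ∀ b ∈ ball (0 : E) 1, b + v ∈ M)
    (hMW : ∀ m ∈ M, ∀ b ∈ ball (0 : E) 1, b + m ∈ W) :
    ∃ n, chainPoints L c P P' n W ⊆ chainPoints L c P P' (n + 1) V := by
  classical
  obtain ⟨K, hK, hKW⟩ := hFLC W hW
  obtain ⟨t, -, ht, hKt⟩ := hK.finite_cover_balls (zero_lt_one (α := ℝ))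
  let F : ℕ → Finset E := fun n => ht.toFinset.filter (· ∈ chainPoints L c P P' n M)
  obtain ⟨n, hn⟩ : ∃ n, ∀ m, (F n).card ≤ (F m).card :=
    ⟨Function.argmin fun m => (F m).card, fun m => Function.argmin_le (fun m => (F m).card) m⟩
  have hF : F (n + 1) = F n :=
    Finset.eq_of_subset_of_card_le
      (Finset.monotone_filter_right _ fun _ _ h => chainPoints_succ_subset n M h) (hn _)
  refine ⟨n, fun y hy => ?_⟩
  obtain ⟨v, hvK, hyv⟩ := hKW y
  obtain ⟨f, hft, hvf⟩ := mem_iUnion₂.1 (hKt hvK)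
  have hb : v - f ∈ ball (0 : E) 1 := by
    rwa [mem_ball_zero_iff, ← dist_eq_norm]
  have hb' : f - v ∈ ball (0 : E) 1 := by
    rwa [mem_ball_zero_iff, norm_sub_rev, ← mem_ball_zero_iff]
  have hv : v ∈ chainPoints L c P P' n W :=
    chainPoints_congr n (fun u hu => (hyv u hu).symm) hy
  have hf : f ∈ chainPoints L c P P' n M := by
    simpa using chainPoints_add n (fun m hm => hMW m hm _ hb') hv
  have hfF : f ∈ F (n + 1) := by
    rw [hF]
    exact Finset.mem_filter.2 ⟨ht.mem_toFinset.2 hft, hf⟩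
  have hvV : v ∈ chainPoints L c P P' (n + 1) V := by
    simpa using chainPoints_add (n + 1) (fun u hu => hVM u hu _ hb) (Finset.mem_filter.1 hfF).2
  exact chainPoints_congr _ (fun u hu => hyv u (by
    have h0 : (0 : E) ∈ ball (0 : E) 1 := mem_ball_self one_pos
    simpa using hMW _ (hVM u hu 0 h0) 0 h0)) hvV

end ChainPoints

theorem IsExpansive.exists_subset_inflate {L : E ≃ₗ[ℝ] E} (hL : IsExpansive L) (c : ℝ)
    {U : Set E} (hU : Bornology.IsBounded U) :
    ∃ (V : Set E) (r : ℝ), U ⊆ V ∧ V ⊆ closedBall 0 r ∧ V ⊆ inflate L c V := by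
  obtain ⟨C, hC, l, hl, hexp⟩ := hL
  have hl0 : 0 < l := one_pos.trans hl
  have hinv (n : ℕ) (x : E) : l ^ n * ‖(L.symm ^ n : E ≃ₗ[ℝ] E) x‖ ≤ ‖x‖ / C := by
    have h := hexp n ((L.symm ^ n : E ≃ₗ[ℝ] E) x)
    have hx : (L ^ n : E ≃ₗ[ℝ] E) ((L.symm ^ n : E ≃ₗ[ℝ] E) x) = x := by
      have : L.symm ^ n = (L ^ n)⁻¹ := inv_pow L n
      rw [this]
      exact (L ^ n).apply_symm_apply x
    rw [hx] at h
    rw [le_div_iff₀ hC]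
    linarith
  obtain ⟨q, hq⟩ := isBounded_iff_forall_norm_le.1 hU
  set r := max (q / C) (c / C / (l - 1)) with hr
  have hrc : r + c / C ≤ l * r := by
    have h := le_max_right (q / C) (c / C / (l - 1))
    rw [← hr, div_le_iff₀ (sub_pos.2 hl)] at h
    linarith
  refine ⟨{x | ∀ n : ℕ, l ^ n * ‖(L.symm ^ n : E ≃ₗ[ℝ] E) x‖ ≤ r}, r, ?_, ?_, ?_⟩
  · intro x hx n
    exact (hinv n x).trans (((div_le_div_iff_of_pos_right hC).2 (hq x hx)).trans
      (le_max_left _ _))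
  · intro x hx
    simpa using hx 0
  · intro x hx b hb n
    have hb' : ‖b‖ / C ≤ c / C := (div_le_div_iff_of_pos_right hC).2 (mem_closedBall_zero_iff.1 hb)
    have hsucc : (L.symm ^ n : E ≃ₗ[ℝ] E) (L.symm (x + b)) =
        (L.symm ^ (n + 1) : E ≃ₗ[ℝ] E) x + (L.symm ^ (n + 1) : E ≃ₗ[ℝ] E) b := by
      rw [← map_add, pow_succ]
      rfl
    have hpow : 0 ≤ l ^ (n + 1) := by positivity
    have h : l * (l ^ n * ‖(L.symm ^ n : E ≃ₗ[ℝ] E) (L.symm (x + b))‖) ≤ l * r := by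
      rw [hsucc]
      calc _ = l ^ (n + 1) * ‖(L.symm ^ (n + 1) : E ≃ₗ[ℝ] E) x +
              (L.symm ^ (n + 1) : E ≃ₗ[ℝ] E) b‖ := by ring
        _ ≤ l ^ (n + 1) * (‖(L.symm ^ (n + 1) : E ≃ₗ[ℝ] E) x‖ +
              ‖(L.symm ^ (n + 1) : E ≃ₗ[ℝ] E) b‖) :=
            mul_le_mul_of_nonneg_left (norm_add_le _ _) hpow
        _ ≤ r + c / C := by
            rw [mul_add]
            exact add_le_add (hx _) ((hinv _ b).trans hb')
        _ ≤ l * r := hrc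
    exact le_of_mul_le_mul_left h hl0

/-- Well-separation is not needed for the nontrivial half of the local isomorphism. -/
theorem IsLSub.lIfrom_predecessor [FiniteDimensional ℝ E] {L : E ≃ₗ[ℝ] E} (hL : IsExpansive L)
    {P P' : E → S} (hFLC : IsFLC P) (hsub : IsLSub L P P') : LIfrom P P' := by
  obtain ⟨hLI, c, hc, hLD⟩ := hsub
  intro U hU y
  obtain ⟨V, r, hUV, hVr, hV⟩ := hL.exists_subset_inflate c hU.isBounded
  have hadd (s : ℝ) : ∀ v ∈ closedBall (0 : E) s, ∀ b ∈ ball (0 : E) 1,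
      b + v ∈ closedBall (0 : E) (s + 1) := by
    intro v hv b hb
    rw [mem_closedBall_zero_iff] at hv ⊢
    rw [mem_ball_zero_iff] at hb
    linarith [norm_add_le b v]
  have hW := isCompact_closedBall (0 : E) (r + 1 + 1)
  obtain ⟨n, hn⟩ := exists_chainPoints_subset (L := L) (c := c) (P' := P') hFLC hW
    (fun v hv => hadd r v (hVr hv)) (hadd (r + 1))
  have hVW : V ⊆ closedBall 0 (r + 1 + 1) :=
    hVr.trans (closedBall_subset_closedBall (by linarith))
  obtain ⟨x, hx⟩ := exists_patchEq_of_chainPoints_subset hc hLI hLD n hVW hW Subset.rfl hV hn y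
  exact ⟨x, fun u hu => hx u (hUV hu)⟩

/-- Theorem: an FLC, well-separated pattern that is `L`-sub with predecessor `P'` and `L`
expansive has `P'` locally isomorphic to `P` (equivalently, equal hulls). -/
theorem stmt5 [FiniteDimensional ℝ E] (L : E ≃ₗ[ℝ] E) (hL : IsExpansive L)
    (P P' : E → S) (hFLC : IsFLC P) (hWS : WellSeparated P) (hsub : IsLSub L P P') :
    LocIso P' P ∧ patternHull P = patternHull P' := by
  have h : LIfrom P P' := hsub.lIfrom_predecessor hL hFLC
  exact ⟨⟨hsub.1, h⟩, Set.ext fun Q => ⟨fun hQ => LIfrom.trans hQ h,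
    fun hQ => LIfrom.trans hQ hsub.1⟩⟩
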